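/- arXiv:1201.4831 — 2 statements merged into one kernel-verified Lean document; each statement's English description precedes it below -/
import Mathlib

section
/- Let b ∈ (0,1). Then there exists a constant c > 0, depending only on b, such that for every integer p ≥ 1, every a > 0 and every s₁ with 0 < |s₁| ≤ p·a, one has J_{p,a}(s₁; b·1_p) ≤ c^p · (p!)^{1−b} · a^{max(p−1−pb, 0)} · |s₁|^{−max(−(p−1−pb), 0)} · (1 + log(p·a/|s₁|))^{ε(p)}, where 1_p is the p-dimensional vector with all entries 1, and ε(p) = 1 if there exists an integer s ∈ {1,…,p} with s(1−b) = 1, and ε(p) = 0 otherwise. -/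
open MeasureTheory

/-- The iterated integral `J_{p,a}(s₁;β)` (the `i`-th coordinate of `β`, `0`-indexed,
plays the role of `β_{i+1}`). It is defined recursively:
`J_{1,a}(s;β) = |s|^{−β₁}` and, for `p ≥ 2`,
`J_{p,a}(s;β) = ∫_{−(p−1)a}^{(p−1)a} |s − t|^{−β₁} J_{p−1,a}(t; (β₂,…,β_p)) dt`. -/
noncomputable def Jint (a : ℝ) : ℕ → (ℕ → ℝ) → ℝ → ℝ
  | 0, _, _ => 1
  | 1, β, s => |s| ^ (-(β 0))
  | (p + 2), β, s =>
      ∫ t in Set.Ioo (-(((p : ℝ) + 1) * a)) (((p : ℝ) + 1) * a),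
        |s - t| ^ (-(β 0)) * Jint a (p + 1) (fun i => β (i + 1)) t

open Classical in
/-- `ε(p) = 1` if `s(1−b) = 1` for some integer `s ∈ {1,…,p}`, else `0`. -/
noncomputable def epsExp (b : ℝ) (p : ℕ) : ℕ :=
  if ∃ s ∈ Finset.Icc 1 p, (s : ℝ) * (1 - b) = 1 then 1 else 0

lemma Jint_nonneg (a : ℝ) (p : ℕ) (β : ℕ → ℝ) (s : ℝ) : 0 ≤ Jint a p β s := by
  induction p using Nat.strong_induction_on generalizing β s with
  | _ p ih =>
    match p with
    | 0 => simp [Jint]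
    | 1 => simpa [Jint] using Real.rpow_nonneg (abs_nonneg s) _
    | p + 2 =>
      rw [Jint]
      exact integral_nonneg fun t =>
        mul_nonneg (Real.rpow_nonneg (abs_nonneg _) _) (ih (p + 1) (by lia) _ _)

lemma Jint_succ_le_integral {a b s : ℝ} {p : ℕ} (hp : 1 ≤ p) {g : ℝ → ℝ}
    (hg : Integrable g) (hg0 : 0 ≤ g)
    (h : ∀ t, 0 < |t| → t ≠ s → |t| < p * a →
      |s - t| ^ (-b) * Jint a p (fun _ => b) t ≤ g t) :
    Jint a (p + 1) (fun _ => b) s ≤ ∫ t, g t := by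
  obtain ⟨p, rfl⟩ : ∃ q, p = q + 1 := ⟨p - 1, by lia⟩
  rw [Jint]
  refine (integral_mono_of_nonneg (ae_of_all _ fun t =>
    mul_nonneg (Real.rpow_nonneg (abs_nonneg _) _) (Jint_nonneg _ _ _ _))
    hg.integrableOn ?_).trans (setIntegral_le_integral hg (ae_of_all _ hg0))
  have h0 : ∀ᵐ t : ℝ, t ≠ 0 := by simp [ae_iff]
  have h1 : ∀ᵐ t : ℝ, t ≠ s := by simp [ae_iff]
  filter_upwards [ae_restrict_mem measurableSet_Ioo, ae_restrict_of_ae h0,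
    ae_restrict_of_ae h1] with t ht ht0 hts
  refine h t (abs_pos.2 ht0) hts (abs_lt.2 ?_)
  push_cast
  exact ht

lemma integrable_indicator_abs {S : Set ℝ} (hS : MeasurableSet S) (hS0 : S ⊆ Set.Ioi 0)
    {h : ℝ → ℝ} (hi : IntegrableOn h S) :
    Integrable (fun x => S.indicator h |x|) ∧
      ∫ x, S.indicator h |x| = 2 * ∫ x in S, h x := by
  constructor
  · have := (integrable_fun_norm_addHaar (E := ℝ) volume (f := S.indicator h)).2
    simp only [Module.finrank_self, Nat.sub_self, pow_zero, one_smul, Real.norm_eq_abs] at this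
    exact this (hi.integrable_indicator hS).integrableOn
  · rw [integral_comp_abs, setIntegral_indicator hS, Set.inter_eq_right.2 hS0]

lemma integrable_rpow_abs_near {A κ : ℝ} (hA : 0 < A) (hκ : κ < 1) :
    Integrable (fun x => (Set.Ioo 0 A).indicator (fun r => r ^ (-κ)) |x|) ∧
      ∫ x, (Set.Ioo 0 A).indicator (fun r => r ^ (-κ)) |x| = 2 * (A ^ (1 - κ) / (1 - κ)) := by
  have hi : IntegrableOn (fun r : ℝ => r ^ (-κ)) (Set.Ioo 0 A) :=
    (intervalIntegral.integrableOn_Ioo_rpow_iff hA).2 (by linarith)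
  refine (integrable_indicator_abs measurableSet_Ioo (fun x hx => hx.1) hi).imp id fun h => ?_
  rw [h, ← integral_Ioc_eq_integral_Ioo, ← intervalIntegral.integral_of_le hA.le,
    integral_rpow (Or.inl (by linarith)), Real.zero_rpow (by linarith)]
  ring_nf

lemma integrable_rpow_abs_far {B κ : ℝ} (hB : 0 < B) (hκ : 1 < κ) :
    Integrable (fun x => (Set.Ici B).indicator (fun r => r ^ (-κ)) |x|) ∧
      ∫ x, (Set.Ici B).indicator (fun r => r ^ (-κ)) |x| = 2 * (B ^ (1 - κ) / (κ - 1)) := by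
  refine (integrable_indicator_abs measurableSet_Ici (fun x hx => hB.trans_le hx)
    ((integrableOn_Ici_iff_integrableOn_Ioi (by finiteness)).2
      (integrableOn_Ioi_rpow_of_lt (by linarith) hB))).imp id fun h => ?_
  rw [h, integral_Ici_eq_integral_Ioi, integral_Ioi_rpow_of_lt (by linarith) hB, neg_div,
    ← div_neg]
  ring_nf

lemma integrable_inv_abs_annulus {B A : ℝ} (hB : 0 < B) (hBA : B ≤ A) :
    Integrable (fun x => (Set.Icc B A).indicator (fun r => r ^ (-1 : ℝ)) |x|) ∧
      ∫ x, (Set.Icc B A).indicator (fun r => r ^ (-1 : ℝ)) |x| = 2 * Real.log (A / B) := by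
  have hi : IntegrableOn (fun r : ℝ => r ^ (-1 : ℝ)) (Set.Icc B A) := by
    rw [integrableOn_Icc_iff_integrableOn_Ioc, ← intervalIntegrable_iff_integrableOn_Ioc_of_le hBA]
    refine intervalIntegral.intervalIntegrable_rpow (Or.inr ?_)
    rw [Set.uIcc_of_le hBA]
    exact fun h => absurd h.1 (by linarith)
  refine (integrable_indicator_abs measurableSet_Icc (fun x hx => hB.trans_le hx.1) hi).imp id
    fun h => ?_
  rw [h, integral_Icc_eq_integral_Ioc, ← intervalIntegral.integral_of_le hBA]
  simp only [Real.rpow_neg_one]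
  rw [integral_inv_of_pos hB (hB.trans_le hBA)]

lemma indicator_rpow_abs_nonneg {S : Set ℝ} (κ x : ℝ) :
    0 ≤ S.indicator (fun r => r ^ (-κ)) |x| := by
  by_cases h : |x| ∈ S
  · simpa [h] using Real.rpow_nonneg (abs_nonneg x) _
  · simp [h]

lemma rpow_mul_rpow_le_add {x y b γ : ℝ} (hx : 0 < x) (hy : 0 < y) (hb : 0 ≤ b) (hγ : 0 ≤ γ) :
    x ^ (-b) * y ^ (-γ) ≤ y ^ (-(b + γ)) + x ^ (-(b + γ)) := by
  have h1 : x ^ (-(b + γ)) = x ^ (-b) * x ^ (-γ) := by rw [neg_add, Real.rpow_add hx]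
  have h2 : y ^ (-(b + γ)) = y ^ (-b) * y ^ (-γ) := by rw [neg_add, Real.rpow_add hy]
  have p1 := Real.rpow_pos_of_pos hx (-b)
  have p2 := Real.rpow_pos_of_pos hx (-γ)
  have p3 := Real.rpow_pos_of_pos hy (-b)
  have p4 := Real.rpow_pos_of_pos hy (-γ)
  rw [h1, h2]
  rcases le_total x y with h | h
  · have := Real.rpow_le_rpow_of_nonpos hx h (neg_nonpos.2 hγ)
    nlinarith [mul_pos p3 p4]
  · have := Real.rpow_le_rpow_of_nonpos hy h (neg_nonpos.2 hb)
    nlinarith [mul_pos p1 p2]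

/-- The product of two shifted singularities is dominated by local singularities at `0` and `s`
and a tail. -/
lemma rpow_mul_rpow_le_split {s t b γ : ℝ} (hs : 0 < |s|) (ht : 0 < |t|) (hts : t ≠ s)
    (hb : 0 ≤ b) (hγ : 0 ≤ γ) {T : Set ℝ} (hT : |s| / 2 ≤ |t| → |t| ∈ T) :
    |s - t| ^ (-b) * |t| ^ (-γ) ≤
      (|s| / 2) ^ (-b) * (Set.Ioo 0 (|s| / 2)).indicator (fun r => r ^ (-γ)) |t|
      + (|s| / 2) ^ (-γ) * (Set.Ioo 0 (|s| / 2)).indicator (fun r => r ^ (-b)) |t - s|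
      + 3 ^ b * T.indicator (fun r => r ^ (-(b + γ))) |t| := by
  have hR : 0 < |s| / 2 := by positivity
  have e1 : 0 ≤ (|s| / 2) ^ (-b) * (Set.Ioo 0 (|s| / 2)).indicator (fun r => r ^ (-γ)) |t| :=
    mul_nonneg (by positivity) (indicator_rpow_abs_nonneg _ _)
  have e2 : 0 ≤ (|s| / 2) ^ (-γ) * (Set.Ioo 0 (|s| / 2)).indicator (fun r => r ^ (-b)) |t - s| :=
    mul_nonneg (by positivity) (indicator_rpow_abs_nonneg _ _)
  have e3 : 0 ≤ (3 : ℝ) ^ b * T.indicator (fun r => r ^ (-(b + γ))) |t| :=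
    mul_nonneg (by positivity) (indicator_rpow_abs_nonneg _ _)
  have htri : |s| ≤ |s - t| + |t| := by simpa using abs_add_le (s - t) t
  have htri' : |t| ≤ |s - t| + |s| := by
    simpa [abs_sub_comm s t] using abs_add_le (t - s) s
  have hst : 0 < |s - t| := abs_pos.2 (sub_ne_zero.2 hts.symm)
  rw [abs_sub_comm t s] at e2 ⊢
  by_cases h1 : |t| < |s| / 2
  · have : |s - t| ^ (-b) * |t| ^ (-γ) ≤
        (|s| / 2) ^ (-b) * (Set.Ioo 0 (|s| / 2)).indicator (fun r => r ^ (-γ)) |t| := by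
      rw [Set.indicator_of_mem (show |t| ∈ Set.Ioo 0 (|s| / 2) from ⟨ht, h1⟩)]
      gcongr ?_ * _
      exact Real.rpow_le_rpow_of_nonpos hR (by linarith) (by linarith)
    linarith
  by_cases h2 : |s - t| < |s| / 2
  · have : |s - t| ^ (-b) * |t| ^ (-γ) ≤
        (|s| / 2) ^ (-γ) * (Set.Ioo 0 (|s| / 2)).indicator (fun r => r ^ (-b)) |s - t| := by
      rw [Set.indicator_of_mem (show |s - t| ∈ Set.Ioo 0 (|s| / 2) from ⟨hst, h2⟩), mul_comm]
      gcongr ?_ * _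
      exact Real.rpow_le_rpow_of_nonpos hR (by linarith) (by linarith)
    linarith
  · push Not at h1 h2
    have : |s - t| ^ (-b) * |t| ^ (-γ) ≤ 3 ^ b * T.indicator (fun r => r ^ (-(b + γ))) |t| := by
      rw [Set.indicator_of_mem (hT h1), neg_add, Real.rpow_add ht, ← mul_assoc]
      gcongr ?_ * _
      calc |s - t| ^ (-b) ≤ (|t| / 3) ^ (-b) :=
            Real.rpow_le_rpow_of_nonpos (by positivity) (by linarith) (by linarith)
        _ = 3 ^ b * |t| ^ (-b) := by
            rw [Real.div_rpow ht.le (by norm_num), Real.rpow_neg (by norm_num : (0 : ℝ) ≤ 3)]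
            field_simp
    linarith

lemma Jint_succ_le_of_tail {a b s γ M I : ℝ} {p : ℕ} (hp : 1 ≤ p) (hb : 0 ≤ b) (hb1 : b < 1)
    (hγ : 0 ≤ γ) (hγ1 : γ < 1) (hM : 0 ≤ M) (hs : 0 < |s|)
    (hJ : ∀ t, 0 < |t| → |t| < p * a → Jint a p (fun _ => b) t ≤ M * |t| ^ (-γ))
    {T : Set ℝ} (hT : ∀ t : ℝ, |s| / 2 ≤ |t| → |t| < p * a → |t| ∈ T)
    (hI : Integrable (fun t => T.indicator (fun r => r ^ (-(b + γ))) |t|) ∧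
      ∫ t, T.indicator (fun r => r ^ (-(b + γ))) |t| = I) :
    Jint a (p + 1) (fun _ => b) s ≤
      M * ((2 / (1 - γ) + 2 / (1 - b)) * (|s| / 2) ^ (1 - (b + γ)) + 3 ^ b * I) := by
  have hR : 0 < |s| / 2 := by positivity
  obtain ⟨i1, v1⟩ := integrable_rpow_abs_near hR hγ1
  obtain ⟨i2, v2⟩ := integrable_rpow_abs_near hR hb1
  have i2' := i2.comp_sub_right s
  have v2' := (integral_sub_right_eq_self
    (fun x : ℝ => (Set.Ioo 0 (|s| / 2)).indicator (fun r => r ^ (-b)) |x|) s).trans v2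
  obtain ⟨i3, v3⟩ := hI
  have j1 := i1.const_mul ((|s| / 2) ^ (-b))
  have j2 := i2'.const_mul ((|s| / 2) ^ (-γ))
  have j3 := i3.const_mul (3 ^ b)
  refine (Jint_succ_le_integral hp (((j1.add j2).add j3).const_mul M) ?_ ?_).trans (le_of_eq ?_)
  · refine fun t => mul_nonneg hM (add_nonneg (add_nonneg ?_ ?_) ?_) <;>
      exact mul_nonneg (by positivity) (indicator_rpow_abs_nonneg _ _)
  · intro t ht hts hta
    calc |s - t| ^ (-b) * Jint a p (fun _ => b) t
        ≤ |s - t| ^ (-b) * (M * |t| ^ (-γ)) := by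
          gcongr
          exact hJ t ht hta
      _ = M * (|s - t| ^ (-b) * |t| ^ (-γ)) := by ring
      _ ≤ _ := mul_le_mul_of_nonneg_left
          (rpow_mul_rpow_le_split hs ht hts hb hγ fun h => hT t h hta) hM
  · rw [integral_const_mul, integral_add' (j1.add j2) j3, integral_add' j1 j2,
      integral_const_mul, integral_const_mul, integral_const_mul, v1, v2', v3]
    have h1 : (|s| / 2) ^ (1 - (b + γ)) = (|s| / 2) ^ (-b) * (|s| / 2) ^ (1 - γ) := by
      rw [← Real.rpow_add hR]; ring_nf
    have h2 : (|s| / 2) ^ (1 - (b + γ)) = (|s| / 2) ^ (-γ) * (|s| / 2) ^ (1 - b) := by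
      rw [← Real.rpow_add hR]; ring_nf
    rw [add_mul]
    nth_rw 1 [h1]
    rw [h2]
    ring

lemma Jint_succ_le_of_add_lt_one {a b s γ M : ℝ} {p : ℕ} (hp : 1 ≤ p) (ha : 0 < a) (hb : 0 ≤ b)
    (hγ : 0 ≤ γ) (hbγ : b + γ < 1) (hM : 0 ≤ M) (hs : |s| ≤ (p + 1 : ℕ) * a)
    (hJ : ∀ t, 0 < |t| → |t| < p * a → Jint a p (fun _ => b) t ≤ M * |t| ^ (-γ)) :
    Jint a (p + 1) (fun _ => b) s ≤
      M * (4 * (3 * (p * a)) ^ (1 - (b + γ)) / (1 - (b + γ))) := by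
  have hp' : (1 : ℝ) ≤ p := by exact_mod_cast hp
  have hA : 0 < 3 * (p * a) := by positivity
  obtain ⟨i1, v1⟩ := integrable_rpow_abs_near hA hbγ
  have i2 := i1.comp_sub_right s
  have v2 := (integral_sub_right_eq_self (fun x : ℝ =>
    (Set.Ioo 0 (3 * (p * a))).indicator (fun r => r ^ (-(b + γ))) |x|) s).trans v1
  refine (Jint_succ_le_integral hp ((i1.add i2).const_mul M) ?_ ?_).trans (le_of_eq ?_)
  · exact fun t => mul_nonneg hM
      (add_nonneg (indicator_rpow_abs_nonneg _ _) (indicator_rpow_abs_nonneg _ _))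
  · intro t ht hts hta
    have hst : 0 < |s - t| := abs_pos.2 (sub_ne_zero.2 hts.symm)
    have hpa : a ≤ p * a := le_mul_of_one_le_left ha.le hp'
    have htri : |s - t| < 3 * (p * a) := by
      have := abs_sub s t
      push_cast at hs
      linarith
    calc |s - t| ^ (-b) * Jint a p (fun _ => b) t
        ≤ |s - t| ^ (-b) * (M * |t| ^ (-γ)) := by
          gcongr
          exact hJ t ht hta
      _ = M * (|s - t| ^ (-b) * |t| ^ (-γ)) := by ring
      _ ≤ M * (|t| ^ (-(b + γ)) + |s - t| ^ (-(b + γ))) :=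
          mul_le_mul_of_nonneg_left (rpow_mul_rpow_le_add hst ht hb hγ) hM
      _ = _ := by
          simp only [Pi.add_apply]
          rw [abs_sub_comm t s,
            Set.indicator_of_mem (show |t| ∈ Set.Ioo 0 (3 * (p * a)) from ⟨ht, by linarith⟩),
            Set.indicator_of_mem (show |s - t| ∈ Set.Ioo 0 (3 * (p * a)) from ⟨hst, htri⟩)]
  · rw [integral_const_mul, integral_add' i1 i2, v1, v2]
    ring

/-- The size of `J_{p,a}(s; b·1_p)` up to a constant depending on `p` and `b`. -/
noncomputable def Jprofile (b a : ℝ) (p : ℕ) (s : ℝ) : ℝ :=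
  if p * (1 - b) < 1 then |s| ^ (p * (1 - b) - 1)
  else if p * (1 - b) = 1 then 1 + Real.log (p * a / |s|)
  else a ^ (p * (1 - b) - 1)

lemma one_le_one_add_log {p : ℕ} {a s : ℝ} (hs : 0 < |s|) (h : |s| ≤ p * a) :
    1 ≤ 1 + Real.log (p * a / |s|) := by
  have := Real.log_nonneg ((one_le_div hs).2 h)
  linarith

lemma one_add_log_le_rpow {x η : ℝ} (hx : 1 ≤ x) (hη : 0 < η) :
    1 + Real.log x ≤ (1 + 1 / η) * x ^ η := by
  have h1 := Real.log_le_rpow_div (zero_le_one.trans hx) hη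
  have h2 := Real.one_le_rpow hx hη.le
  calc 1 + Real.log x ≤ x ^ η + x ^ η / η := add_le_add h2 h1
    _ = _ := by ring

lemma Jint_succ_le_profile {b C a s : ℝ} {p : ℕ} (hb : 0 < b) (hb1 : b < 1) (hp : 1 ≤ p)
    (h : 1 < p * (1 - b)) (hC : 0 ≤ C) (ha : 0 < a)
    (hJ : ∀ t, 0 < |t| → |t| ≤ p * a → Jint a p (fun _ => b) t ≤ C * Jprofile b a p t)
    (hs : |s| ≤ (p + 1 : ℕ) * a) :
    Jint a (p + 1) (fun _ => b) s ≤
      C * (12 / (1 - b) * p ^ (1 - b)) * Jprofile b a (p + 1) s := by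
  have hδ : 0 < 1 - b := by linarith
  have h' : 1 < ((p + 1 : ℕ) : ℝ) * (1 - b) := by push_cast; linarith
  have h3 : (3 : ℝ) ^ (1 - b) ≤ 3 := by
    simpa using Real.rpow_le_rpow_of_exponent_le (by norm_num : (1 : ℝ) ≤ 3)
      (by linarith : 1 - b ≤ 1)
  refine (Jint_succ_le_of_add_lt_one hp ha hb.le le_rfl (by linarith)
    (M := C * a ^ (p * (1 - b) - 1)) (by positivity) hs ?_).trans ?_
  · intro t ht hta
    have := hJ t ht hta.le
    rw [Jprofile, if_neg h.not_gt, if_neg h.ne'] at this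
    rwa [neg_zero, Real.rpow_zero, mul_one]
  · rw [Jprofile, if_neg h'.not_gt, if_neg h'.ne', add_zero,
      Real.mul_rpow (by norm_num) (by positivity), Real.mul_rpow (by positivity) ha.le,
      show ((p + 1 : ℕ) : ℝ) * (1 - b) - 1 = (p * (1 - b) - 1) + (1 - b) by push_cast; ring,
      Real.rpow_add ha]
    calc C * a ^ (p * (1 - b) - 1) * (4 * (3 ^ (1 - b) * (p ^ (1 - b) * a ^ (1 - b))) / (1 - b))
        ≤ C * a ^ (p * (1 - b) - 1) * (4 * (3 * (p ^ (1 - b) * a ^ (1 - b))) / (1 - b)) := by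
          gcongr
      _ = _ := by ring

lemma exists_Jint_le_profile {b : ℝ} (hb : 0 < b) (hb1 : b < 1) {p : ℕ} (hp : 1 ≤ p) :
    ∃ C > 0, ∀ a > (0 : ℝ), ∀ s : ℝ, 0 < |s| → |s| ≤ p * a →
      Jint a p (fun _ => b) s ≤ C * Jprofile b a p s := by
  induction p, hp using Nat.le_induction with
  | base =>
    refine ⟨1, one_pos, fun a ha s hs hsa => ?_⟩
    simp [Jint, Jprofile, hb]
  | succ p hp ih =>
    obtain ⟨C, hC, ih⟩ := ih
    have hp' : (1 : ℝ) ≤ p := by exact_mod_cast hp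
    have hδ : 0 < 1 - b := by linarith
    have hpδ : 1 - b ≤ p * (1 - b) := le_mul_of_one_le_left hδ.le hp'
    have hsucc : ((p + 1 : ℕ) : ℝ) * (1 - b) = p * (1 - b) + (1 - b) := by push_cast; ring
    rcases lt_trichotomy (p * (1 - b)) 1 with h | h | h
    · set γ := 1 - p * (1 - b) with hγ
      have hJ : ∀ a > (0 : ℝ), ∀ t : ℝ, 0 < |t| → |t| < p * a →
          Jint a p (fun _ => b) t ≤ C * |t| ^ (-γ) := by
        intro a ha t ht hta
        have := ih a ha t ht hta.le
        rwa [Jprofile, if_pos h, show (p : ℝ) * (1 - b) - 1 = -γ by rw [hγ]; ring] at this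
      have hE : 1 - (b + γ) = ((p + 1 : ℕ) : ℝ) * (1 - b) - 1 := by rw [hsucc, hγ]; ring
      have hγ0 : 0 < γ := by linarith
      have hγ1 : γ < 1 := by linarith
      have hγ1' : 0 < 1 - γ := by linarith
      rcases lt_trichotomy (((p + 1 : ℕ) : ℝ) * (1 - b)) 1 with h' | h' | h'
      · have hκ : 1 < b + γ := by linarith
        have hκ' : 0 < b + γ - 1 := by linarith
        refine ⟨C * ((2 / (1 - γ) + 2 / (1 - b) + 3 ^ b * (2 / (b + γ - 1)))
          * (1 / 2) ^ (1 - (b + γ))), by positivity, fun a ha s hs hsa => ?_⟩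
        refine (Jint_succ_le_of_tail hp hb.le hb1 hγ0.le hγ1 hC.le hs (hJ a ha)
          (T := Set.Ici (|s| / 2)) (fun t h _ => h)
          (integrable_rpow_abs_far (by positivity) hκ)).trans (le_of_eq ?_)
        rw [Jprofile, if_pos h', ← hE, div_eq_mul_one_div |s| 2,
          Real.mul_rpow hs.le (by norm_num)]
        ring
      · have hκ : b + γ = 1 := by linarith
        refine ⟨C * (2 / (1 - γ) + 2 / (1 - b) + 3 ^ b * 2), by positivity,
          fun a ha s hs hsa => ?_⟩
        have hlt : |s| / 2 ≤ (p + 1 : ℕ) * a := by linarith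
        refine (Jint_succ_le_of_tail hp hb.le hb1 hγ0.le hγ1 hC.le hs (hJ a ha)
          (T := Set.Icc (|s| / 2) ((p + 1 : ℕ) * a)) (fun t h h2 => ⟨h, ?_⟩)
          (by rw [hκ]; exact integrable_inv_abs_annulus (by positivity) hlt)).trans ?_
        · push_cast
          linarith
        rw [Jprofile, if_neg h'.not_lt, if_pos h', hκ, sub_self, Real.rpow_zero, mul_assoc]
        have hL := one_le_one_add_log hs hsa
        set L := 1 + Real.log ((p + 1 : ℕ) * a / |s|) with hLdef
        have hlog : Real.log ((p + 1 : ℕ) * a / (|s| / 2)) ≤ L := by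
          rw [show ((p + 1 : ℕ) : ℝ) * a / (|s| / 2) = 2 * ((p + 1 : ℕ) * a / |s|) by field_simp,
            Real.log_mul two_ne_zero (by positivity)]
          linarith [Real.log_two_lt_d9]
        gcongr
        calc (2 / (1 - γ) + 2 / (1 - b)) * 1 + 3 ^ b * (2 * Real.log ((p + 1 : ℕ) * a / (|s| / 2)))
            ≤ (2 / (1 - γ) + 2 / (1 - b)) * L + 3 ^ b * (2 * L) := by gcongr
          _ = _ := by ring
      · refine ⟨C * (4 * (3 * p) ^ (1 - (b + γ)) / (1 - (b + γ))), ?_, fun a ha s hs hsa => ?_⟩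
        · have : 0 < 1 - (b + γ) := by linarith
          positivity
        refine (Jint_succ_le_of_add_lt_one hp ha hb.le hγ0.le (by linarith) hC.le hsa
          (hJ a ha)).trans (le_of_eq ?_)
        rw [Jprofile, if_neg h'.not_gt, if_neg h'.ne', ← hE, ← mul_assoc 3,
          Real.mul_rpow (by positivity) ha.le]
        ring
    · set η := (1 - b) / 2 with hη
      have hη0 : 0 < η := by positivity
      have hη1 : 0 < 1 - (b + η) := by linarith
      refine ⟨C * (1 + 1 / η) * p ^ η * (4 * (3 * p) ^ (1 - (b + η)) / (1 - (b + η))),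
        by positivity, fun a ha s hs hsa => ?_⟩
      refine (Jint_succ_le_of_add_lt_one hp ha hb.le hη0.le (by linarith)
        (M := C * (1 + 1 / η) * (p * a) ^ η) (by positivity) hsa ?_).trans (le_of_eq ?_)
      · intro t ht hta
        have := ih a ha t ht hta.le
        rw [Jprofile, if_neg h.not_lt, if_pos h] at this
        refine this.trans ?_
        rw [mul_assoc, mul_assoc]
        gcongr
        refine (one_add_log_le_rpow ((one_le_div ht).2 hta.le) hη0).trans (le_of_eq ?_)
        rw [Real.div_rpow (by positivity) ht.le, Real.rpow_neg ht.le, div_eq_mul_inv _ (|t| ^ η)]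
      · have h' : 1 < ((p + 1 : ℕ) : ℝ) * (1 - b) := by linarith
        rw [Jprofile, if_neg h'.not_gt, if_neg h'.ne', ← mul_assoc 3,
          Real.mul_rpow (by positivity) ha.le, Real.mul_rpow (by positivity) ha.le,
          show ((p + 1 : ℕ) : ℝ) * (1 - b) - 1 = η + (1 - (b + η)) by linarith,
          Real.rpow_add ha]
        ring
    · exact ⟨C * (12 / (1 - b) * p ^ (1 - b)), by positivity, fun a ha s _ hsa =>
        Jint_succ_le_profile hb hb1 hp h hC.le ha (ih a ha) hsa⟩

lemma Jprofile_le {b a s : ℝ} {p : ℕ} (hs : 0 < |s|) (hsa : |s| ≤ p * a) (hp : 1 ≤ p) :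
    Jprofile b a p s ≤ a ^ (max ((p : ℝ) - 1 - p * b) 0)
      * |s| ^ (-(max (-((p : ℝ) - 1 - p * b)) 0))
      * (1 + Real.log (p * a / |s|)) ^ (epsExp b p) := by
  have hp' : (0 : ℝ) < p := by exact_mod_cast hp
  have ha : 0 < a := pos_of_mul_pos_right (hs.trans_le hsa) hp'.le
  have hL := one_le_one_add_log hs hsa
  have hLε := one_le_pow₀ hL (n := epsExp b p)
  rw [show (p : ℝ) - 1 - p * b = p * (1 - b) - 1 by ring, Jprofile]
  split_ifs with h1 h2
  · rw [max_eq_right (by linarith), max_eq_left (by linarith), neg_neg, Real.rpow_zero, one_mul]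
    exact le_mul_of_one_le_right (by positivity) hLε
  · have hε : epsExp b p = 1 := if_pos ⟨p, Finset.mem_Icc.2 ⟨hp, le_rfl⟩, h2⟩
    simp [h2, hε]
  · have h3 : 1 < p * (1 - b) := lt_of_le_of_ne (not_lt.1 h1) (Ne.symm h2)
    rw [max_eq_left (by linarith), max_eq_right (by linarith), neg_zero, Real.rpow_zero, mul_one]
    exact le_mul_of_one_le_right (by positivity) hLε

/-- For `b ∈ (0,1)` there is a constant `c > 0`, depending only
on `b`, such that for every integer `p ≥ 1`, every `a > 0` and every `s₁`
with `0 < |s₁| ≤ p·a`,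
`J_{p,a}(s₁; b·1_p) ≤ c^p (p!)^{1−b} a^{(p−1−pb)₊} |s₁|^{−(p−1−pb)₋}
(1 + log(p·a/|s₁|))^{ε(p)}`. -/
theorem stmt_12 (b : ℝ) (hb1 : 0 < b) (hb2 : b < 1) :
    ∃ c > (0 : ℝ), ∀ p : ℕ, 1 ≤ p → ∀ a > (0 : ℝ), ∀ s₁ : ℝ,
      0 < |s₁| → |s₁| ≤ p * a →
      Jint a p (fun _ => b) s₁
        ≤ c ^ p * (p.factorial : ℝ) ^ (1 - b)
            * a ^ (max ((p : ℝ) - 1 - p * b) 0)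
            * |s₁| ^ (-(max (-((p : ℝ) - 1 - p * b)) 0))
            * (1 + Real.log (p * a / |s₁|)) ^ (epsExp b p) := by
  have hδ : 0 < 1 - b := by linarith
  have hex : ∀ p : ℕ, ∃ C > 0, 1 ≤ p → ∀ a > (0 : ℝ), ∀ s : ℝ, 0 < |s| → |s| ≤ p * a →
      Jint a p (fun _ => b) s ≤ C * Jprofile b a p s := by
    intro p
    by_cases hp : 1 ≤ p
    · obtain ⟨C, hC, h⟩ := exists_Jint_le_profile hb1 hb2 hp
      exact ⟨C, hC, fun _ => h⟩
    · exact ⟨1, one_pos, fun h => absurd h hp⟩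
  choose C hC hJ using hex
  obtain ⟨N, hN⟩ := exists_nat_gt (1 / (1 - b))
  rw [div_lt_iff₀ hδ] at hN
  have hN1 : 1 ≤ N := by
    rcases Nat.eq_zero_or_pos N with rfl | h
    · norm_num at hN
    · exact h
  have hsum : 0 ≤ ∑ q ∈ Finset.range (N + 1), C q := Finset.sum_nonneg fun q _ => (hC q).le
  have h12 : 0 < 12 / (1 - b) := by positivity
  set c := 12 / (1 - b) + 1 + ∑ q ∈ Finset.range (N + 1), C q with hc
  have hc1 : 1 ≤ c := by linarith
  have hc0 : 0 < c := by linarith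
  have small : ∀ p : ℕ, 1 ≤ p → p ≤ N → C p ≤ c ^ p * (p.factorial : ℝ) ^ (1 - b) := by
    intro p hp hpN
    have h1 : C p ≤ c := by
      have := Finset.single_le_sum (fun q _ => (hC q).le)
        (Finset.mem_range.2 (Nat.lt_succ_of_le hpN))
      linarith
    have h2 : (1 : ℝ) ≤ (p.factorial : ℝ) ^ (1 - b) :=
      Real.one_le_rpow (by exact_mod_cast p.factorial_pos) hδ.le
    exact (h1.trans (le_self_pow₀ hc1 (by lia))).trans (le_mul_of_one_le_right (by positivity) h2)
  have profile_nonneg : ∀ (p : ℕ) (a : ℝ), 0 < a → ∀ s : ℝ, 0 < |s| → |s| ≤ p * a →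
      0 ≤ Jprofile b a p s := by
    intro p a ha s hs hsa
    have := one_le_one_add_log hs hsa
    unfold Jprofile
    split_ifs <;> positivity
  have main : ∀ p : ℕ, 1 ≤ p → ∀ a > (0 : ℝ), ∀ s : ℝ, 0 < |s| → |s| ≤ p * a →
      Jint a p (fun _ => b) s ≤ c ^ p * (p.factorial : ℝ) ^ (1 - b) * Jprofile b a p s := by
    have low : ∀ p : ℕ, 1 ≤ p → p ≤ N → ∀ a > (0 : ℝ), ∀ s : ℝ, 0 < |s| → |s| ≤ p * a →
        Jint a p (fun _ => b) s ≤ c ^ p * (p.factorial : ℝ) ^ (1 - b) * Jprofile b a p s :=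
      fun p hp hpN a ha s hs hsa => (hJ p hp a ha s hs hsa).trans
        (mul_le_mul_of_nonneg_right (small p hp hpN) (profile_nonneg p a ha s hs hsa))
    intro p hp
    rcases le_total p N with hpN | hpN
    · exact low p hp hpN
    clear hp
    induction p, hpN using Nat.le_induction with
    | base => exact low N hN1 le_rfl
    | succ p hpN ih =>
      intro a ha s hs hsa
      have hpN' : (N : ℝ) ≤ p := by exact_mod_cast hpN
      have h : 1 < p * (1 - b) := hN.trans_le (by gcongr)
      refine (Jint_succ_le_profile hb1 hb2 (hN1.trans hpN) h (by positivity) ha (ih a ha)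
        hsa).trans ?_
      refine mul_le_mul_of_nonneg_right ?_ (profile_nonneg _ a ha s hs hsa)
      rw [Nat.factorial_succ, Nat.cast_mul, Real.mul_rpow (by positivity) (by positivity), pow_succ]
      calc c ^ p * (p.factorial : ℝ) ^ (1 - b) * (12 / (1 - b) * p ^ (1 - b))
          ≤ c ^ p * (p.factorial : ℝ) ^ (1 - b) * (c * ((p + 1 : ℕ) : ℝ) ^ (1 - b)) := by
            gcongr
            · linarith
            · lia
        _ = _ := by ring
  refine ⟨c, hc0, fun p hp a ha s hs hsa => (main p hp a ha s hs hsa).trans ?_⟩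
  rw [mul_assoc _ (a ^ _), mul_assoc _ (a ^ _ * _)]
  exact mul_le_mul_of_nonneg_left (Jprofile_le hs hsa hp) (by positivity)
end

section
/- Let d ∈ (0, 1/2) and let (c_q)_{q ≥ 1} be a sequence of real numbers satisfying: for every λ > 0 there exists a constant K_λ such that |c_q| ≤ K_λ · (q!)^d · e^{−λq} for all q ≥ 1. Then for every constant C > 0, the double series ∑_{q,q' ≥ 1} ∑_{p=0}^{min(q,q')} (|c_q|/q!) · (|c_{q'}|/q'!) · p! · binom(q,p) · binom(q',p) · C^{(q+q')/2} · Λ₂(q−p, p)^{1/2} · Λ₂(q'−p, p)^{1/2} converges (is finite). -/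
/-- `Λ₂(a₁,a₂) = (a₁!·a₂!)^{1−2d}`. -/
noncomputable def Lambda2 (d : ℝ) (a₁ a₂ : ℕ) : ℝ :=
  ((a₁.factorial : ℝ) * (a₂.factorial : ℝ)) ^ (1 - 2*d)

/-- Each of the two factors of the series, taken with its share `(p!)^{1/2}` of `p!`, is at most
`2^q` times the geometric part of the bound on the coefficient. -/
theorem coeff_mul_choose_mul_Lambda2_le {d : ℝ} (hd : d < 1 / 2) {a B : ℝ} {q p : ℕ} (hB : 0 ≤ B)
    (hpq : p ≤ q) (ha : a ≤ B * (q.factorial : ℝ) ^ d) :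
    a / (q.factorial : ℝ) * (q.choose p : ℝ) * Lambda2 d (q - p) p ^ ((1 : ℝ) / 2)
      * (p.factorial : ℝ) ^ ((1 : ℝ) / 2) ≤ B * 2 ^ q := by
  have hA : (0 : ℝ) < q.factorial := by positivity
  have hchoose : (q.choose p : ℝ) ≤ 2 ^ q := by exact_mod_cast Nat.choose_le_two_pow q p
  have hle : ((q - p).factorial : ℝ) * (p.factorial : ℝ) ≤ q.factorial := by
    have := Nat.le_of_dvd q.factorial_pos (Nat.factorial_mul_factorial_dvd_factorial hpq)
    rw [mul_comm] at this
    exact_mod_cast this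
  have hLambda : Lambda2 d (q - p) p ^ ((1 : ℝ) / 2) ≤ (q.factorial : ℝ) ^ (1 / 2 - d) := by
    rw [Lambda2, ← Real.rpow_mul (by positivity),
      show (1 - 2 * d) * ((1 : ℝ) / 2) = 1 / 2 - d by ring]
    exact Real.rpow_le_rpow (by positivity) hle (by linarith)
  have hp : (p.factorial : ℝ) ^ ((1 : ℝ) / 2) ≤ (q.factorial : ℝ) ^ ((1 : ℝ) / 2) :=
    Real.rpow_le_rpow (by positivity) (by exact_mod_cast Nat.factorial_le hpq) (by norm_num)
  have hLambda_nonneg : 0 ≤ Lambda2 d (q - p) p ^ ((1 : ℝ) / 2) := by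
    unfold Lambda2; positivity
  have hpow : (q.factorial : ℝ) ^ d * (q.factorial : ℝ) ^ (1 / 2 - d)
      * (q.factorial : ℝ) ^ ((1 : ℝ) / 2) = q.factorial := by
    rw [← Real.rpow_add hA, ← Real.rpow_add hA,
      show d + (1 / 2 - d) + 1 / 2 = (1 : ℝ) by ring, Real.rpow_one]
  calc
    _ ≤ B * (q.factorial : ℝ) ^ d / (q.factorial : ℝ) * 2 ^ q * (q.factorial : ℝ) ^ (1 / 2 - d)
        * (q.factorial : ℝ) ^ ((1 : ℝ) / 2) := by gcongr
    _ = B * 2 ^ q * ((q.factorial : ℝ) ^ d * (q.factorial : ℝ) ^ (1 / 2 - d)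
        * (q.factorial : ℝ) ^ ((1 : ℝ) / 2)) / (q.factorial : ℝ) := by ring
    _ = B * 2 ^ q := by rw [hpow]; field_simp

open Classical in
/-- Let `d ∈ (0,1/2)` and `(c_q)` satisfy: for every `λ > 0` there
is `K_λ` with `|c_q| ≤ K_λ (q!)^d e^{−λq}` for all `q ≥ 1`. Then for every
`C > 0` the double series
`∑_{q,q'≥1} ∑_{p=0}^{q∧q'} (|c_q|/q!)(|c_{q'}|/q'!) p! C(q,p) C(q',p)
C^{(q+q')/2} Λ₂(q−p,p)^{1/2} Λ₂(q'−p,p)^{1/2}` converges. -/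
theorem stmt_13 (d : ℝ) (hd1 : 0 < d) (hd2 : d < 1/2)
    (c : ℕ → ℝ)
    (hc : ∀ lam > (0 : ℝ), ∃ K : ℝ, ∀ q : ℕ, 1 ≤ q →
      |c q| ≤ K * (q.factorial : ℝ) ^ d * Real.exp (-lam * q)) :
    ∀ C > (0 : ℝ),
      Summable (fun x : ℕ × ℕ × ℕ =>
        if 1 ≤ x.1 ∧ 1 ≤ x.2.1 ∧ x.2.2 ≤ min x.1 x.2.1 then
          (|c x.1| / (x.1.factorial : ℝ)) * (|c x.2.1| / (x.2.1.factorial : ℝ))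
            * (x.2.2.factorial : ℝ)
            * (x.1.choose x.2.2 : ℝ) * (x.2.1.choose x.2.2 : ℝ)
            * C ^ (((x.1 : ℝ) + (x.2.1 : ℝ)) / 2)
            * (Lambda2 d (x.1 - x.2.2) x.2.2) ^ ((1 : ℝ)/2)
            * (Lambda2 d (x.2.1 - x.2.2) x.2.2) ^ ((1 : ℝ)/2)
        else 0) := by
  intro C hC
  have hsqrt : 0 < √C := Real.sqrt_pos.mpr hC
  set t : ℝ := (8 * √C + 2)⁻¹ with ht
  have ht_pos : 0 < t := by positivity
  have hr : 2 * t * √C ≤ 1 / 4 := by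
    rw [ht, mul_right_comm, ← div_eq_mul_inv, div_le_iff₀ (by positivity)]
    linarith
  obtain ⟨K, hK⟩ := hc (Real.log (8 * √C + 2)) (Real.log_pos (by linarith))
  have hexp (q : ℕ) : Real.exp (-Real.log (8 * √C + 2) * q) = t ^ q := by
    rw [mul_comm, Real.exp_nat_mul, Real.exp_neg, Real.exp_log (by positivity)]
  have hbound (q : ℕ) (hq : 1 ≤ q) : |c q| ≤ |K| * t ^ q * (q.factorial : ℝ) ^ d := by
    have h := hK q hq
    rw [hexp] at h
    calc
      _ ≤ K * (q.factorial : ℝ) ^ d * t ^ q := h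
      _ ≤ |K| * (q.factorial : ℝ) ^ d * t ^ q := by gcongr; exact le_abs_self K
      _ = _ := by ring
  have hgeom : Summable fun n : ℕ => ((1 : ℝ) / 2) ^ n := summable_geometric_two
  have hgeom_nonneg : 0 ≤ fun n : ℕ => ((1 : ℝ) / 2) ^ n := fun n => by positivity
  have hdom := (hgeom.mul_of_nonneg (hgeom.mul_of_nonneg hgeom hgeom_nonneg hgeom_nonneg)
    hgeom_nonneg (fun x => by positivity)).mul_left (|K| ^ 2)
  refine Summable.of_nonneg_of_le (fun x => ?_) (fun x => ?_) hdom
  · unfold Lambda2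
    split_ifs <;> positivity
  · obtain ⟨q, q', p⟩ := x
    dsimp only
    split_ifs with h
    · obtain ⟨hq, hq', hp⟩ := h
      obtain ⟨hpq, hpq'⟩ := le_min_iff.mp hp
      have h₁ := coeff_mul_choose_mul_Lambda2_le hd2 (by positivity) hpq (hbound q hq)
      have h₂ := coeff_mul_choose_mul_Lambda2_le hd2 (by positivity) hpq' (hbound q' hq')
      have hfac : (p.factorial : ℝ)
          = (p.factorial : ℝ) ^ ((1 : ℝ) / 2) * (p.factorial : ℝ) ^ ((1 : ℝ) / 2) := by
        rw [← Real.rpow_add (by positivity)]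
        norm_num
      have hCpow : C ^ (((q : ℝ) + (q' : ℝ)) / 2) = √C ^ q * √C ^ q' := by
        rw [← pow_add, Real.sqrt_eq_rpow, ← Real.rpow_natCast, ← Real.rpow_mul hC.le]
        push_cast
        ring_nf
      have hnonneg : 0 ≤ |c q'| / (q'.factorial : ℝ) * (q'.choose p : ℝ)
          * Lambda2 d (q' - p) p ^ ((1 : ℝ) / 2) * (p.factorial : ℝ) ^ ((1 : ℝ) / 2) := by
        unfold Lambda2; positivity
      calc
        _ = (|c q| / (q.factorial : ℝ) * (q.choose p : ℝ) * Lambda2 d (q - p) p ^ ((1 : ℝ) / 2)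
              * (p.factorial : ℝ) ^ ((1 : ℝ) / 2))
            * (|c q'| / (q'.factorial : ℝ) * (q'.choose p : ℝ)
              * Lambda2 d (q' - p) p ^ ((1 : ℝ) / 2) * (p.factorial : ℝ) ^ ((1 : ℝ) / 2))
            * (√C ^ q * √C ^ q') := by
          rw [hCpow]
          nth_rewrite 1 [hfac]
          ring
        _ ≤ (|K| * t ^ q * 2 ^ q) * (|K| * t ^ q' * 2 ^ q') * (√C ^ q * √C ^ q') := by gcongr
        _ = |K| ^ 2 * ((2 * t * √C) ^ q * (2 * t * √C) ^ q') := by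
          simp only [mul_pow]
          ring
        _ ≤ |K| ^ 2 * ((1 / 4) ^ q * (1 / 4) ^ q') := by gcongr
        _ = |K| ^ 2 * ((1 / 2) ^ q * ((1 / 2) ^ q' * ((1 / 2) ^ q * (1 / 2) ^ q'))) := by
          rw [show (1 / 4 : ℝ) = 1 / 2 * (1 / 2) by norm_num, mul_pow, mul_pow]
          ring
        _ ≤ |K| ^ 2 * ((1 / 2) ^ q * ((1 / 2) ^ q' * (1 / 2) ^ p)) := by
          rw [← pow_add (1 / 2 : ℝ) q q']
          have hpow : (1 / 2 : ℝ) ^ (q + q') ≤ (1 / 2) ^ p :=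
            pow_le_pow_of_le_one (by norm_num) (by norm_num) (by omega)
          gcongr
    · positivity
end
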